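/- Let B be a unital complex Banach algebra, I a set, N ≥ 1, and for every n ∈ {0,1,…,N} let α_n be a bounded n-multilinear map Bⁿ → B (with α₀ ∈ B). Fix i ∈ I and set X = Σ_{n=0}^{N−1} (V_{i,n}(α_n) + W_{i,n}(α_n)) and Y = X + V_{i,N}(α_N) + W_{i,N}(α_N). Then for all b₀, …, b_N ∈ B, ℰ(b₀ Y b₁ Y ⋯ b_N Y) = b₀ α_N(b₁α₀, b₂α₀, …, b_Nα₀) + ℰ(b₀ X b₁ X ⋯ b_N X), where elements of B act on 𝔉 via λ. -/

import Mathlib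

open scoped Topology ENNReal

noncomputable section

variable (B : Type*) [NormedRing B] [NormedAlgebra ℂ B] [CompleteSpace B]
variable (I : Type*) [DecidableEq I]

abbrev D := lp (fun _ : I => B) 1

def delta (i : I) : D B I := lp.single 1 i (1 : B)

def lsmul (b : B) (d : D B I) : D B I :=
  ⟨fun i => b * d i, by
    apply memℓp_gen
    have h1 : Summable fun i => ‖d i‖ ^ (1 : ℝ≥0∞).toReal :=
      (lp.memℓp d).summable (by norm_num)
    simp only [ENNReal.toReal_one, Real.rpow_one] at h1 ⊢
    exact Summable.of_nonneg_of_le (fun i => norm_nonneg _)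
      (fun i => norm_mul_le b (d i)) (h1.mul_left ‖b‖)⟩

/-- The Fock-space construction of Dykema's paper: `F` plays the role of
`𝔉 = BΩ ⊕ ⨁_{k ≥ 1} D^{⊗̂k} ⊗̂ B`, with `τ k d b₀` the elementary tensor
`d 0 ⊗ ⋯ ⊗ d k ⊗ b₀` (`k+1` factors from `D`), `lam` the left action of `B`,
`rho` the right action of `B`, `P` the projection onto `BΩ` and the operators
`L i`, `V i n αₙ`, `W i n αₙ` as defined in the paper. -/
structure FockSetup (F : Type*) [NormedAddCommGroup F] [NormedSpace ℂ F] [CompleteSpace F] where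
  Ω : F
  τ : (k : ℕ) → (Fin (k + 1) → D B I) → B → F
  lam : B →ₐ[ℂ] (F →L[ℂ] F)
  rho : B → (F →L[ℂ] F)
  P : F →L[ℂ] B
  L : I → (F →L[ℂ] F)
  V : (i : I) → (n : ℕ) → ContinuousMultilinearMap ℂ (fun _ : Fin n => B) B → (F →L[ℂ] F)
  W : (i : I) → (n : ℕ) → ContinuousMultilinearMap ℂ (fun _ : Fin n => B) B → (F →L[ℂ] F)
  dense_span : Dense (↑(Submodule.span ℂ
      ((Set.range fun b : B => lam b Ω) ∪
        {x | ∃ (k : ℕ) (d : Fin (k + 1) → D B I) (b₀ : B), x = τ k d b₀})) : Set F)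
  lam_tensor : ∀ (b : B) (k : ℕ) (d : Fin (k + 1) → D B I) (b₀ : B),
    lam b (τ k d b₀) = τ k (Function.update d 0 (lsmul B I b (d 0))) b₀
  rho_lam_omega : ∀ b b₀ : B, rho b (lam b₀ Ω) = lam (b₀ * b) Ω
  rho_tensor : ∀ (b : B) (k : ℕ) (d : Fin (k + 1) → D B I) (b₀ : B),
    rho b (τ k d b₀) = τ k d (b₀ * b)
  P_lam_omega : ∀ b : B, P (lam b Ω) = b
  P_tensor : ∀ (k : ℕ) (d : Fin (k + 1) → D B I) (b₀ : B), P (τ k d b₀) = 0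
  L_omega : ∀ (i : I) (b₀ : B), L i (lam b₀ Ω) = τ 0 (fun _ => delta B I i) b₀
  L_tensor : ∀ (i : I) (k : ℕ) (d : Fin (k + 1) → D B I) (b₀ : B),
    L i (τ k d b₀) = τ (k + 1) (Fin.cons (delta B I i) d) b₀
  V_zero : ∀ (i : I) (α : ContinuousMultilinearMap ℂ (fun _ : Fin 0 => B) B),
    V i 0 α = lam (α 0)
  W_zero : ∀ (i : I) (α : ContinuousMultilinearMap ℂ (fun _ : Fin 0 => B) B),
    W i 0 α = lam (α 0) * L i
  V_omega : ∀ (i : I) (n : ℕ), 1 ≤ n →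
    ∀ (α : ContinuousMultilinearMap ℂ (fun _ : Fin n => B) B) (b₀ : B),
      V i n α (lam b₀ Ω) = 0
  W_omega : ∀ (i : I) (n : ℕ), 1 ≤ n →
    ∀ (α : ContinuousMultilinearMap ℂ (fun _ : Fin n => B) B) (b₀ : B),
      W i n α (lam b₀ Ω) = 0
  V_tensor_lt : ∀ (i : I) (n : ℕ) (α : ContinuousMultilinearMap ℂ (fun _ : Fin n => B) B)
      (k : ℕ) (d : Fin (k + 1) → D B I) (b₀ : B), k + 1 < n →
    V i n α (τ k d b₀) = 0
  W_tensor_lt : ∀ (i : I) (n : ℕ) (α : ContinuousMultilinearMap ℂ (fun _ : Fin n => B) B)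
      (k : ℕ) (d : Fin (k + 1) → D B I) (b₀ : B), k + 1 < n →
    W i n α (τ k d b₀) = 0
  V_tensor_eq : ∀ (i : I) (k : ℕ) (α : ContinuousMultilinearMap ℂ (fun _ : Fin (k + 1) => B) B)
      (d : Fin (k + 1) → D B I) (b₀ : B),
    V i (k + 1) α (τ k d b₀) = lam (α (fun j => d j i) * b₀) Ω
  W_tensor_eq : ∀ (i : I) (k : ℕ) (α : ContinuousMultilinearMap ℂ (fun _ : Fin (k + 1) => B) B)
      (d : Fin (k + 1) → D B I) (b₀ : B),
    W i (k + 1) α (τ k d b₀) = lam (α (fun j => d j i)) (τ 0 (fun _ => delta B I i) b₀)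
  V_tensor_gt : ∀ (i : I) (n : ℕ), 1 ≤ n →
    ∀ (α : ContinuousMultilinearMap ℂ (fun _ : Fin n => B) B)
      (k : ℕ) (d : Fin (k + 1) → D B I) (b₀ : B) (h : n ≤ k),
    V i n α (τ k d b₀) =
      lam (α fun j => d (Fin.castLE (by omega) j) i)
        (τ (k - n) (fun j : Fin (k - n + 1) => d ⟨n + (j : ℕ), by omega⟩) b₀)
  W_tensor_gt : ∀ (i : I) (n : ℕ), 1 ≤ n →
    ∀ (α : ContinuousMultilinearMap ℂ (fun _ : Fin n => B) B)
      (k : ℕ) (d : Fin (k + 1) → D B I) (b₀ : B) (h : n ≤ k),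
    W i n α (τ k d b₀) =
      lam (α fun j => d (Fin.castLE (by omega) j) i)
        (τ (k - n + 1) (Fin.cons (delta B I i)
          (fun j : Fin (k - n + 1) => d ⟨n + (j : ℕ), by omega⟩)) b₀)

variable {B} {I}
variable {F : Type*} [NormedAddCommGroup F] [NormedSpace ℂ F] [CompleteSpace F]

/-- The expectation `ℰ(X) = P(XΩ)`. -/
def FockSetup.Ec (S : FockSetup B I F) (X : F →L[ℂ] F) : B := S.P (X S.Ω)

namespace FockSetup

omit [CompleteSpace B]

variable (S : FockSetup B I F)

/-- The span of the elementary tensors of degree less than `m`, where `lam c Ω` has degree `0` and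
`τ k d c` has degree `k + 1`. -/
def degreeLT (m : ℕ) : Submodule ℂ F :=
  Submodule.span ℂ
    ({x | 0 < m ∧ ∃ c : B, x = S.lam c S.Ω} ∪
      {x | ∃ (k : ℕ) (d : Fin (k + 1) → D B I) (c : B), k + 1 < m ∧ x = S.τ k d c})

variable {S}

theorem lam_omega_mem_degreeLT {m : ℕ} (hm : 0 < m) (c : B) : S.lam c S.Ω ∈ S.degreeLT m :=
  Submodule.subset_span (Or.inl ⟨hm, c, rfl⟩)

theorem tensor_mem_degreeLT {m k : ℕ} (hk : k + 1 < m) (d : Fin (k + 1) → D B I) (c : B) :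
    S.τ k d c ∈ S.degreeLT m :=
  Submodule.subset_span (Or.inr ⟨k, d, c, hk, rfl⟩)

theorem omega_mem_degreeLT {m : ℕ} (hm : 0 < m) : S.Ω ∈ S.degreeLT m := by
  simpa using lam_omega_mem_degreeLT (S := S) hm 1

theorem map_mem_of_mem_degreeLT {T : F →L[ℂ] F} {m : ℕ} {p : Submodule ℂ F}
    (hΩ : 0 < m → ∀ c : B, T (S.lam c S.Ω) ∈ p)
    (hτ : ∀ (k : ℕ) (d : Fin (k + 1) → D B I) (c : B), k + 1 < m → T (S.τ k d c) ∈ p)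
    {x : F} (hx : x ∈ S.degreeLT m) : T x ∈ p := by
  have h : S.degreeLT m ≤ p.comap (T : F →ₗ[ℂ] F) := by
    refine Submodule.span_le.mpr ?_
    rintro _ (⟨hm, c, rfl⟩ | ⟨k, d, c, hk, rfl⟩)
    · exact hΩ hm c
    · exact hτ k d c hk
  exact h hx

theorem lam_lam (a b : B) (x : F) : S.lam a (S.lam b x) = S.lam (a * b) x := by
  rw [map_mul, mul_apply_eq_comp]

theorem lam_mem_degreeLT (b : B) {m : ℕ} {x : F} (hx : x ∈ S.degreeLT m) :
    S.lam b x ∈ S.degreeLT m := by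
  refine map_mem_of_mem_degreeLT (fun hm c => ?_) (fun k d c hk => ?_) hx
  · rw [lam_lam]
    exact lam_omega_mem_degreeLT hm _
  · rw [S.lam_tensor]
    exact tensor_mem_degreeLT hk _ _

theorem L_mem_degreeLT (i : I) {m : ℕ} {x : F} (hx : x ∈ S.degreeLT m) :
    S.L i x ∈ S.degreeLT (m + 1) := by
  refine map_mem_of_mem_degreeLT (fun hm c => ?_) (fun k d c hk => ?_) hx
  · rw [S.L_omega]
    exact tensor_mem_degreeLT (by omega) _ _
  · rw [S.L_tensor]
    exact tensor_mem_degreeLT (by omega) _ _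

theorem V_mem_degreeLT (i : I) (n : ℕ) (α : ContinuousMultilinearMap ℂ (fun _ : Fin n => B) B)
    {m : ℕ} {x : F} (hx : x ∈ S.degreeLT m) : S.V i n α x ∈ S.degreeLT m := by
  obtain rfl | hn := n.eq_zero_or_pos
  · rw [S.V_zero]
    exact lam_mem_degreeLT _ hx
  refine map_mem_of_mem_degreeLT (fun hm c => ?_) (fun k d c hk => ?_) hx
  · rw [S.V_omega i n hn]
    exact zero_mem _
  · obtain h | rfl | h := lt_trichotomy (k + 1) n
    · rw [S.V_tensor_lt i n α k d c h]
      exact zero_mem _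
    · rw [S.V_tensor_eq]
      exact lam_omega_mem_degreeLT (by omega) _
    · rw [S.V_tensor_gt i n hn α k d c (by omega)]
      exact lam_mem_degreeLT _ (tensor_mem_degreeLT (by omega) _ _)

theorem W_mem_degreeLT (i : I) {n : ℕ} (hn : 1 ≤ n)
    (α : ContinuousMultilinearMap ℂ (fun _ : Fin n => B) B)
    {m : ℕ} {x : F} (hx : x ∈ S.degreeLT m) : S.W i n α x ∈ S.degreeLT m := by
  refine map_mem_of_mem_degreeLT (fun hm c => ?_) (fun k d c hk => ?_) hx
  · rw [S.W_omega i n hn]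
    exact zero_mem _
  · obtain h | rfl | h := lt_trichotomy (k + 1) n
    · rw [S.W_tensor_lt i n α k d c h]
      exact zero_mem _
    · rw [S.W_tensor_eq]
      exact lam_mem_degreeLT _ (tensor_mem_degreeLT (by omega) _ _)
    · rw [S.W_tensor_gt i n hn α k d c (by omega)]
      exact lam_mem_degreeLT _ (tensor_mem_degreeLT (by omega) _ _)

theorem W_zero_mem_degreeLT (i : I) (α : ContinuousMultilinearMap ℂ (fun _ : Fin 0 => B) B)
    {m : ℕ} {x : F} (hx : x ∈ S.degreeLT m) : S.W i 0 α x ∈ S.degreeLT (m + 1) := by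
  rw [S.W_zero]
  exact lam_mem_degreeLT _ (L_mem_degreeLT i hx)

theorem V_eq_zero_of_mem_degreeLT (i : I) {n : ℕ} (hn : 1 ≤ n)
    (α : ContinuousMultilinearMap ℂ (fun _ : Fin n => B) B) {x : F} (hx : x ∈ S.degreeLT n) :
    S.V i n α x = 0 := by
  rw [← Submodule.mem_bot ℂ]
  refine map_mem_of_mem_degreeLT (fun hm c => ?_) (fun k d c hk => ?_) hx
  · rw [S.V_omega i n hn]
    exact zero_mem _
  · rw [S.V_tensor_lt i n α k d c hk]
    exact zero_mem _

theorem W_eq_zero_of_mem_degreeLT (i : I) {n : ℕ} (hn : 1 ≤ n)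
    (α : ContinuousMultilinearMap ℂ (fun _ : Fin n => B) B) {x : F} (hx : x ∈ S.degreeLT n) :
    S.W i n α x = 0 := by
  rw [← Submodule.mem_bot ℂ]
  refine map_mem_of_mem_degreeLT (fun hm c => ?_) (fun k d c hk => ?_) hx
  · rw [S.W_omega i n hn]
    exact zero_mem _
  · rw [S.W_tensor_lt i n α k d c hk]
    exact zero_mem _

theorem degreeLT_mono {m n : ℕ} (h : m ≤ n) : S.degreeLT m ≤ S.degreeLT n := by
  refine Submodule.span_mono ?_
  rintro x (⟨hm, c, rfl⟩ | ⟨k, d, c, hk, rfl⟩)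
  · exact Or.inl ⟨hm.trans_le h, c, rfl⟩
  · exact Or.inr ⟨k, d, c, hk.trans_le h, rfl⟩

/-- Up to terms of lower order, `∑ n < N, (V i n (α n) + W i n (α n))` acts as `W i 0 (α 0)`. -/
theorem sum_sub_W_zero_mem_degreeLT {N : ℕ} (hN : 1 ≤ N)
    (α : (n : ℕ) → ContinuousMultilinearMap ℂ (fun _ : Fin n => B) B) (i : I)
    {m : ℕ} {x : F} (hx : x ∈ S.degreeLT m) :
    (∑ n ∈ Finset.range N, (S.V i n (α n) + S.W i n (α n))) x - S.W i 0 (α 0) x ∈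
      S.degreeLT m := by
  obtain ⟨N, rfl⟩ := Nat.exists_eq_add_of_le' hN
  rw [Finset.sum_range_succ', add_apply, add_apply, ← add_assoc, add_sub_cancel_right,
    sum_apply]
  refine add_mem (sum_mem fun n _ => ?_) (V_mem_degreeLT i 0 _ hx)
  exact add_mem (V_mem_degreeLT i _ _ hx) (W_mem_degreeLT i (by omega) _ hx)

theorem prod_W_zero_omega_mem_degreeLT (i : I)
    (α : ContinuousMultilinearMap ℂ (fun _ : Fin 0 => B) B) {m : ℕ} (b : Fin m → B) :
    (List.ofFn fun j => S.lam (b j) * S.W i 0 α).prod S.Ω ∈ S.degreeLT (m + 1) := by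
  induction m with
  | zero => simpa using omega_mem_degreeLT (S := S) one_pos
  | succ m ih =>
    rw [List.ofFn_succ, List.prod_cons]
    exact lam_mem_degreeLT _ (W_zero_mem_degreeLT i _ (ih fun j => b j.succ))

theorem prod_W_zero_omega (i : I) (α : ContinuousMultilinearMap ℂ (fun _ : Fin 0 => B) B)
    {k : ℕ} (b : Fin (k + 1) → B) :
    (List.ofFn fun j => S.lam (b j) * S.W i 0 α).prod S.Ω =
      S.τ k (fun j => lsmul B I (b j * α 0) (delta B I i)) 1 := by
  induction k with
  | zero =>
    have h : S.L i S.Ω = S.τ 0 (fun _ => delta B I i) 1 := by simpa using S.L_omega i 1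
    rw [List.ofFn_succ, List.ofFn_zero, List.prod_singleton, S.W_zero,
      mul_apply_eq_comp, mul_apply_eq_comp, h, lam_lam, S.lam_tensor]
    congr 1
    ext j : 1
    rw [Fin.fin_one_eq_zero j, Function.update_self]
  | succ k ih =>
    rw [List.ofFn_succ, List.prod_cons, mul_apply_eq_comp, ih fun j => b j.succ,
      S.W_zero, mul_apply_eq_comp, mul_apply_eq_comp, S.L_tensor, lam_lam,
      S.lam_tensor, Fin.update_cons_zero, Fin.cons_zero]
    congr 1
    ext j : 1
    cases j using Fin.cases <;> rfl

theorem prod_sum_omega_sub_mem_degreeLT {N : ℕ} (hN : 1 ≤ N)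
    (α : (n : ℕ) → ContinuousMultilinearMap ℂ (fun _ : Fin n => B) B) (i : I)
    {X : F →L[ℂ] F} (hX : X = ∑ n ∈ Finset.range N, (S.V i n (α n) + S.W i n (α n)))
    {m : ℕ} (b : Fin m → B) :
    (List.ofFn fun j => S.lam (b j) * X).prod S.Ω -
      (List.ofFn fun j => S.lam (b j) * S.W i 0 (α 0)).prod S.Ω ∈ S.degreeLT m := by
  induction m with
  | zero => simp
  | succ m ih =>
    have hr := ih fun j => b j.succ
    have ht := prod_W_zero_omega_mem_degreeLT (S := S) i (α 0) fun j => b j.succ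
    simp only [List.ofFn_succ, List.prod_cons, mul_apply_eq_comp]
    set x := (List.ofFn fun j : Fin m => S.lam (b j.succ) * X).prod S.Ω
    set t := (List.ofFn fun j : Fin m => S.lam (b j.succ) * S.W i 0 (α 0)).prod S.Ω
    have hx : x ∈ S.degreeLT (m + 1) := by
      simpa using add_mem (degreeLT_mono m.le_succ hr) ht
    rw [← map_sub, ← sub_add_sub_cancel _ (S.W i 0 (α 0) x), ← map_sub (S.W i 0 (α 0))]
    refine lam_mem_degreeLT _ (add_mem ?_ (W_zero_mem_degreeLT i _ hr))
    rw [hX]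
    exact sum_sub_W_zero_mem_degreeLT hN α i hx

theorem prod_sum_omega_mem_degreeLT {N : ℕ} (hN : 1 ≤ N)
    (α : (n : ℕ) → ContinuousMultilinearMap ℂ (fun _ : Fin n => B) B) (i : I)
    {X : F →L[ℂ] F} (hX : X = ∑ n ∈ Finset.range N, (S.V i n (α n) + S.W i n (α n)))
    {m : ℕ} (b : Fin m → B) :
    (List.ofFn fun j => S.lam (b j) * X).prod S.Ω ∈ S.degreeLT (m + 1) := by
  simpa using add_mem
    (degreeLT_mono m.le_succ (prod_sum_omega_sub_mem_degreeLT hN α i hX b))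
    (prod_W_zero_omega_mem_degreeLT (S := S) i (α 0) b)

end FockSetup

/-- Lemma 3.4: adding the top-degree creation/annihilation terms changes the `N`-th moment by
exactly `b₀ α_N(b₁α₀, …, b_Nα₀)`. -/
theorem stmt_9 (S : FockSetup B I F) (N : ℕ) (hN : 1 ≤ N)
    (α : (n : ℕ) → ContinuousMultilinearMap ℂ (fun _ : Fin n => B) B) (i : I)
    (X Y : F →L[ℂ] F)
    (hX : X = ∑ n ∈ Finset.range N, (S.V i n (α n) + S.W i n (α n)))
    (hY : Y = X + S.V i N (α N) + S.W i N (α N))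
    (b : Fin (N + 1) → B) :
    S.Ec (List.ofFn fun j => S.lam (b j) * Y).prod =
      b 0 * α N (fun j : Fin N => b j.succ * α 0 0) +
        S.Ec (List.ofFn fun j => S.lam (b j) * X).prod := by
  have hYX : ∀ {m : ℕ} (_ : m ≤ N) (c : Fin m → B),
      (List.ofFn fun j => S.lam (c j) * Y).prod S.Ω =
        (List.ofFn fun j => S.lam (c j) * X).prod S.Ω := by
    intro m hm c
    induction m with
    | zero => simp
    | succ m ih =>
      simp only [List.ofFn_succ, List.prod_cons, mul_apply_eq_comp]
      rw [ih (by omega) fun j => c j.succ]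
      have hx : (List.ofFn fun j : Fin m => S.lam (c j.succ) * X).prod S.Ω ∈ S.degreeLT N :=
        FockSetup.degreeLT_mono hm
          (FockSetup.prod_sum_omega_mem_degreeLT hN α i hX fun j => c j.succ)
      rw [hY, add_apply, add_apply, FockSetup.V_eq_zero_of_mem_degreeLT i hN _ hx,
        FockSetup.W_eq_zero_of_mem_degreeLT i hN _ hx, add_zero, add_zero]
  have hr := FockSetup.prod_sum_omega_sub_mem_degreeLT hN α i hX fun j => b j.succ
  have hV := FockSetup.V_eq_zero_of_mem_degreeLT i hN (α N) hr
  have hW := FockSetup.W_eq_zero_of_mem_degreeLT i hN (α N) hr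
  rw [map_sub, sub_eq_zero] at hV hW
  have hδ : ∀ a : B, lsmul B I a (delta B I i) i = a := fun a => by
    simp [lsmul, delta]
  simp only [FockSetup.Ec, List.ofFn_succ, List.prod_cons, mul_apply_eq_comp]
  rw [hYX le_rfl fun j => b j.succ, hY, add_apply, add_apply, hV, hW]
  obtain ⟨k, rfl⟩ := Nat.exists_eq_add_of_le' hN
  rw [FockSetup.prod_W_zero_omega, S.V_tensor_eq, S.W_tensor_eq]
  simp only [map_add, FockSetup.lam_lam, S.P_lam_omega, S.lam_tensor, S.P_tensor, hδ, mul_one,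
    add_zero]
  exact add_comm _ _
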